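/- The maps τ₊ and τ₋ are well-defined involutions of the set Φ≥−1 of almost positive roots, and for any α ∈ Φ≥−1 the orbit of α under the group generated by τ₊ and τ₋ satisfies exactly one of the following: (i) it has (h+2)/2 elements and its intersection with −Π is a single root β, which satisfies w₀ β = −β; or (ii) it has h+2 elements and its intersection with −Π consists of exactly two roots β, β′, which satisfy −w₀ β = β′. -/

import Mathlib

open scoped RealInnerProductSpace

noncomputable section

variable {V : Type*} [NormedAddCommGroup V] [InnerProductSpace ℝ V]

open scoped Classical in
/-- The map `τ_ε` on almost positive roots: `τ_ε(β) = β` if `β = -α i` for an index `i`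
in the opposite part `l` of the bipartition, and `τ_ε(β) = c_ε(β)` otherwise.  (It is part
of the statement below that this restricts to an involution of the almost positive roots.) -/
def tauMap {ι : Type*} (l : List ι) (α : ι → V) (cc : V ≃ₗᵢ[ℝ] V) : V → V :=
  fun β => if ∃ i ∈ l, β = -α i then β else cc β

/-- The orbit of `β` under the group of maps generated by the two involutions `f` and `g`:
the set of points reachable from `β` by repeatedly applying `f` and `g`. -/
def dihedralOrbit (f g : V → V) (β : V) : Set V :=
  {γ : V | Relation.ReflTransGen (fun x y => y = f x ∨ y = g x) β γ}


theorem Matrix.exists_pos_eigenvector {ι : Type*} [Fintype ι] [Nonempty ι]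
    (M : Matrix ι ι ℝ) (hM : M.IsHermitian) (hoff : ∀ i j, i ≠ j → M i j ≤ 0)
    (hconn : ∀ Z : Set ι, (∀ i ∈ Z, ∀ j ∉ Z, M i j = 0) → Z = ∅ ∨ Z = Set.univ) :
    ∃ (x : ι → ℝ) (μ : ℝ), (∀ i, 0 < x i) ∧ ∀ i, ∑ j, M i j * x j = μ * x i := by
  classical
  let T : EuclideanSpace ℝ ι →L[ℝ] EuclideanSpace ℝ ι := Matrix.toEuclideanCLM (𝕜 := ℝ) M
  have hT : IsSelfAdjoint T := by
    have : IsSelfAdjoint M := hM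
    exact this.map (Matrix.toEuclideanCLM (𝕜 := ℝ))
  have hTapp : ∀ x i, T x i = ∑ j, M i j * x j := by
    intro x i
    rfl
  have hR : ∀ x, T.reApplyInnerSelf x = ∑ i, ∑ j, M i j * (x i * x j) := by
    intro x
    rw [ContinuousLinearMap.reApplyInnerSelf_apply, PiLp.inner_apply]
    simp only [RCLike.re_to_real, hTapp, RCLike.inner_apply, conj_trivial, Finset.mul_sum]
    refine Finset.sum_congr rfl fun i _ => Finset.sum_congr rfl fun j _ => by ring
  obtain ⟨x₀, hx₀, hmin⟩ := (isCompact_sphere (0 : EuclideanSpace ℝ ι) 1).exists_isMinOn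
    (NormedSpace.sphere_nonempty.2 zero_le_one)
    (T.reApplyInnerSelf_continuous.continuousOn)
  let y : EuclideanSpace ℝ ι := WithLp.toLp 2 fun i => |x₀ i|
  have hy : ‖y‖ = 1 := by
    have : ‖x₀‖ = 1 := by simpa using hx₀
    rw [← this, EuclideanSpace.norm_eq, EuclideanSpace.norm_eq]
    simp [y]
  have hle : T.reApplyInnerSelf y ≤ T.reApplyInnerSelf x₀ := by
    rw [hR, hR]
    refine Finset.sum_le_sum fun i _ => Finset.sum_le_sum fun j _ => ?_
    change M i j * (|x₀ i| * |x₀ j|) ≤ _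
    by_cases hij : i = j
    · subst hij
      rw [abs_mul_abs_self]
    · rw [← abs_mul]
      exact mul_le_mul_of_nonpos_left (le_abs_self _) (hoff i j hij)
  have hymin : IsMinOn T.reApplyInnerSelf (Metric.sphere 0 ‖y‖) y := by
    rw [hy]
    intro z hz
    exact hle.trans (hmin hz)
  have heig := hT.eq_smul_self_of_isLocalExtrOn_real (Or.inl hymin.localize)
  set μ := T.rayleighQuotient y
  have hev : ∀ i, ∑ j, M i j * |x₀ j| = μ * |x₀ i| := by
    intro i
    have := congrArg (fun v : EuclideanSpace ℝ ι => v i) heig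
    simpa [hTapp, y] using this
  have hZ : ∀ i ∈ {i | x₀ i = 0}, ∀ j ∉ {i | x₀ i = 0}, M i j = 0 := by
    intro i (hi : x₀ i = 0) j (hj : x₀ j ≠ 0)
    have h := hev i
    rw [hi, abs_zero, mul_zero] at h
    have h2 := (Finset.sum_eq_zero_iff_of_nonpos (fun k _ => by
      by_cases hk : i = k
      · subst hk; simp [hi]
      · exact mul_nonpos_of_nonpos_of_nonneg (hoff i k hk) (abs_nonneg _))).1 h j
        (Finset.mem_univ _)
    exact (mul_eq_zero.1 h2).resolve_right (abs_ne_zero.2 hj)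
  refine ⟨fun i => |x₀ i|, μ, ?_, hev⟩
  rcases hconn _ hZ with h | h
  · intro i
    have : i ∉ {i | x₀ i = 0} := by simp [h]
    exact abs_pos.2 this
  · exfalso
    have : x₀ = 0 := by
      ext i
      have : i ∈ {i | x₀ i = 0} := by simp [h]
      exact this
    simp [this] at hx₀

theorem apply_eq_of_mod_two {X : Type*} {t : ℕ → X} (ht : ∀ n, t (n + 2) = t n) {a b : ℕ}
    (h : a % 2 = b % 2) : t a = t b := by
  have key : ∀ q r, t (r + 2 * q) = t r := by
    intro q r
    induction q with
    | zero => rfl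
    | succ q ih => rw [← ih, ← ht (r + 2 * q)]; rfl
  rw [← Nat.mod_add_div a 2, ← Nat.mod_add_div b 2, key, key, h]

theorem dihedralOrbit_eq_of_mem {X : Type*} {f g : X → X} {A : Set X}
    (hfA : ∀ x ∈ A, f x ∈ A) (hgA : ∀ x ∈ A, g x ∈ A)
    (hf : ∀ x ∈ A, f (f x) = x) (hg : ∀ x ∈ A, g (g x) = x)
    {β γ : X} (hβ : β ∈ A) (h : γ ∈ dihedralOrbit f g β) :
    dihedralOrbit f g β = dihedralOrbit f g γ := by
  have key : γ ∈ A ∧ β ∈ dihedralOrbit f g γ := by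
    induction h with
    | refl => exact ⟨hβ, Relation.ReflTransGen.refl⟩
    | tail _ hstep ih =>
      obtain ⟨hA, hr⟩ := ih
      rcases hstep with rfl | rfl
      · exact ⟨hfA _ hA, Relation.ReflTransGen.head (Or.inl (hf _ hA).symm) hr⟩
      · exact ⟨hgA _ hA, Relation.ReflTransGen.head (Or.inr (hg _ hA).symm) hr⟩
  ext δ
  exact ⟨fun hδ => Relation.ReflTransGen.trans key.2 hδ,
    fun hδ => Relation.ReflTransGen.trans h hδ⟩

section Walk

variable {X : Type*} {t : ℕ → X → X} {x : ℕ → X} {k m : ℕ}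

theorem dihedralOrbit_eq_image_walk (ht : ∀ n, t (n + 2) = t n)
    (hx : ∀ n ≤ m, x (n + 1) = t (k + n + 1) (x n))
    (hx' : ∀ n ≤ m, x n = t (k + n + 1) (x (n + 1)))
    (h_start : t k (x 0) = x 0) (h_end : t (k + m + 2) (x (m + 1)) = x (m + 1)) :
    dihedralOrbit (t 0) (t 1) (x 0) = x '' Set.Iic (m + 1) := by
  have hpair : ∀ a v w, (w = t 0 v ∨ w = t 1 v) ↔ (w = t a v ∨ w = t (a + 1) v) := by
    intro a v w
    rcases Nat.mod_two_eq_zero_or_one a with h | h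
    · rw [apply_eq_of_mod_two ht (show 0 % 2 = a % 2 by omega),
        apply_eq_of_mod_two ht (show 1 % 2 = (a + 1) % 2 by omega)]
    · rw [apply_eq_of_mod_two ht (show 1 % 2 = a % 2 by omega),
        apply_eq_of_mod_two ht (show 0 % 2 = (a + 1) % 2 by omega), or_comm]
  apply Set.Subset.antisymm
  · intro y hy
    induction hy with
    | refl => exact ⟨0, by simp, rfl⟩
    | @tail b c _ hstep ih =>
      obtain ⟨n, hn, rfl⟩ := ih
      rw [Set.mem_Iic] at hn
      rw [hpair (k + n)] at hstep
      rcases hstep with rfl | rfl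
      · cases n with
        | zero => exact ⟨0, by simp, h_start.symm⟩
        | succ n => exact ⟨n, by rw [Set.mem_Iic]; omega, hx' n (by omega)⟩
      · rcases Nat.lt_or_ge m n with h | h
        · obtain rfl : n = m + 1 := by omega
          exact ⟨m + 1, by simp, h_end.symm⟩
        · exact ⟨n + 1, by rw [Set.mem_Iic]; omega, hx n h⟩
  · rintro _ ⟨n, hn, rfl⟩
    rw [Set.mem_Iic] at hn
    induction n with
    | zero => exact Relation.ReflTransGen.refl
    | succ n ih =>
      exact Relation.ReflTransGen.tail (ih (by omega))
        ((hpair (k + n) _ _).2 (Or.inr (hx n (by omega))))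

theorem walk_coincidence (ht : ∀ n, t (n + 2) = t n)
    (hx : ∀ n ≤ m, x (n + 1) = t (k + n + 1) (x n))
    (hx' : ∀ n ≤ m, x n = t (k + n + 1) (x (n + 1)))
    {N : Set X} (h0 : x 0 ∈ N) (h1 : x (m + 1) ∈ N) (hN : ∀ n, 1 ≤ n → n ≤ m → x n ∉ N)
    (hpar : m % 2 = 1 → x 0 ≠ x (m + 1)) {i j : ℕ} (hij : i < j) (hj : j ≤ m + 1)
    (h : x i = x j) : i + j = m + 1 ∧ x 0 = x (m + 1) := by
  have same : ∀ d i j, i % 2 = j % 2 → i + d ≤ m + 1 → j + d ≤ m + 1 →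
      x (i + d) = x (j + d) → x i = x j := by
    intro d
    induction d with
    | zero => intro i j _ _ _ h; exact h
    | succ d ih =>
      intro i j hp hi hj h
      refine ih i j hp (by omega) (by omega) ?_
      rw [hx' (i + d) (by omega), hx' (j + d) (by omega),
        apply_eq_of_mod_two ht (show (k + (i + d) + 1) % 2 = (k + (j + d) + 1) % 2 by omega)]
      exact congrArg _ h
  have opp : ∀ d i j, (i + d + j) % 2 = 1 → i + d ≤ m + 1 → j + d ≤ m + 1 →
      x (i + d) = x j → x i = x (j + d) := by
    intro d
    induction d with
    | zero => intro i j _ _ _ h; exact h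
    | succ d ih =>
      intro i j hp hi hj h
      have := ih i (j + 1) (by omega) (by omega) (by omega) ?_
      · rw [this]; congr 1; omega
      rw [hx' (i + d) (by omega), hx j (by omega),
        apply_eq_of_mod_two ht (show (k + (i + d) + 1) % 2 = (k + j + 1) % 2 by omega)]
      exact congrArg _ h
  have hzero : ∀ n, 0 < n → n ≤ m + 1 → x 0 = x n → n = m + 1 := by
    intro n hn hn' he
    by_contra hne
    exact hN n hn (by omega) (he ▸ h0)
  by_cases hp : i % 2 = j % 2
  · have h2 := same i 0 (j - i) (by omega) (by omega) (by omega) (by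
      rw [Nat.zero_add, h]; congr 1; omega)
    have h3 := hzero _ (by omega) (by omega) h2
    exact absurd (h3 ▸ h2) (hpar (by omega))
  · by_cases hle : i + j ≤ m + 1
    · have h2 := opp i 0 j (by omega) (by omega) (by omega) (by rw [Nat.zero_add, h])
      have h3 := hzero _ (by omega) (by omega) h2
      exact ⟨by omega, h3 ▸ h2⟩
    · exfalso
      have h2 := opp (m + 1 - j) (i - (m + 1 - j)) j (by omega) (by omega) (by omega) (by
        rw [← h]; congr 1; omega)
      rw [show j + (m + 1 - j) = m + 1 by omega] at h2
      exact hN (i - (m + 1 - j)) (by omega) (by omega) (h2 ▸ h1)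

theorem ncard_image_walk (ht : ∀ n, t (n + 2) = t n)
    (hx : ∀ n ≤ m, x (n + 1) = t (k + n + 1) (x n))
    (hx' : ∀ n ≤ m, x n = t (k + n + 1) (x (n + 1)))
    {N : Set X} (h0 : x 0 ∈ N) (h1 : x (m + 1) ∈ N) (hN : ∀ n, 1 ≤ n → n ≤ m → x n ∉ N)
    (hpar : m % 2 = 1 → x 0 ≠ x (m + 1)) :
    (x 0 = x (m + 1) → 2 * (x '' Set.Iic (m + 1)).ncard = m + 2) ∧
      (x 0 ≠ x (m + 1) → (x '' Set.Iic (m + 1)).ncard = m + 2) := by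
  have key := fun {i j : ℕ} => walk_coincidence (i := i) (j := j) ht hx hx' h0 h1 hN hpar
  constructor
  · intro he
    have hm : m % 2 = 0 := by
      by_contra h
      exact hpar (by omega) he
    have hpal : ∀ n ≤ m + 1, x n = x (m + 1 - n) := by
      intro n
      induction n with
      | zero => intro _; exact he
      | succ n ih =>
        intro hn
        have h2 := hx' (m + 1 - (n + 1)) (by omega)
        rw [h2, hx n (by omega), ih (by omega),
          apply_eq_of_mod_two ht
            (show (k + n + 1) % 2 = (k + (m + 1 - (n + 1)) + 1) % 2 by omega)]
        congr 2
        omega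
    have himg : x '' Set.Iic (m + 1) = x '' Set.Iic (m / 2) := by
      apply Set.Subset.antisymm
      · rintro _ ⟨n, hn, rfl⟩
        rw [Set.mem_Iic] at hn
        by_cases h : n ≤ m / 2
        · exact ⟨n, h, rfl⟩
        · exact ⟨m + 1 - n, by rw [Set.mem_Iic]; omega, (hpal n hn).symm⟩
      · exact Set.image_mono (Set.Iic_subset_Iic.2 (by omega))
    have hinj : Set.InjOn x (Set.Iic (m / 2)) := by
      intro i hi j hj h
      rw [Set.mem_Iic] at hi hj
      rcases lt_trichotomy i j with hlt | hlt | hlt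
      · have := (key hlt (by omega) h).1; omega
      · exact hlt
      · have := (key hlt (by omega) h.symm).1; omega
    rw [himg, hinj.ncard_image, ← Finset.coe_Iic, Set.ncard_coe_finset, Nat.card_Iic]
    omega
  · intro hne
    have hinj : Set.InjOn x (Set.Iic (m + 1)) := by
      intro i hi j hj h
      rw [Set.mem_Iic] at hi hj
      rcases lt_trichotomy i j with hlt | hlt | hlt
      · exact absurd (key hlt (by omega) h).2 hne
      · exact hlt
      · exact absurd (key hlt (by omega) h.symm).2 hne
    rw [hinj.ncard_image, ← Finset.coe_Iic, Set.ncard_coe_finset, Nat.card_Iic]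

end Walk

/-- A finite reduced irreducible root system `Φ` with base `b` and simple reflections `s`. -/
structure IsSimpleSystem {ι : Type*} (Φ : Set V) (b : Module.Basis ι ℝ V) (s : ι → V ≃ₗᵢ[ℝ] V) :
    Prop where
  finite : Φ.Finite
  zero_notMem : (0 : V) ∉ Φ
  reduced : ∀ β ∈ Φ, ∀ r : ℝ, r • β ∈ Φ → r = 1 ∨ r = -1
  neg_mem : ∀ β ∈ Φ, -β ∈ Φ
  simple_mem : ∀ i, b i ∈ Φ
  refl_mem : ∀ i, ∀ β ∈ Φ, s i β ∈ Φ
  refl_apply : ∀ i v, s i v = v - (2 * ⟪v, b i⟫ / ⟪b i, b i⟫) • b i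
  repr_sign : ∀ β ∈ Φ, (∀ i, 0 ≤ b.repr β i) ∨ (∀ i, b.repr β i ≤ 0)
  irreducible : ∀ Φ₁ Φ₂ : Set V, Φ₁.Nonempty → Φ₂.Nonempty → Φ₁ ∪ Φ₂ = Φ →
    (∀ x ∈ Φ₁, ∀ y ∈ Φ₂, ⟪x, y⟫ = 0) → False

/-- The positive roots of `Φ` with respect to the base `b`. -/
def positiveRoots {ι : Type*} (Φ : Set V) (b : Module.Basis ι ℝ V) : Set V :=
  {β ∈ Φ | ∀ i, 0 ≤ b.repr β i}

/-- A two-colouring of the base into orthogonal parts, extended periodically: `L n` is one part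
for even `n` and the other part for odd `n`. -/
structure IsBipartition {ι : Type*} (b : Module.Basis ι ℝ V) (L : ℕ → List ι) : Prop where
  periodic : ∀ n, L (n + 2) = L n
  nodup : ∀ n, (L n).Nodup
  mem_succ_iff : ∀ n i, i ∈ L (n + 1) ↔ i ∉ L n
  orthogonal : ∀ n, ∀ i ∈ L n, ∀ j ∈ L n, i ≠ j → ⟪b i, b j⟫ = 0

/-- The product of the simple reflections in the `n`-th part. -/
def partProd {ι : Type*} (s : ι → V ≃ₗᵢ[ℝ] V) (L : ℕ → List ι) (n : ℕ) : V ≃ₗᵢ[ℝ] V :=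
  ((L n).map s).prod

/-- The alternating product with `n` factors of the two `partProd`s, where the part `k` is
applied first. -/
def altProd {ι : Type*} (s : ι → V ≃ₗᵢ[ℝ] V) (L : ℕ → List ι) (k : ℕ) : ℕ → V ≃ₗᵢ[ℝ] V
  | 0 => 1
  | n + 1 => partProd s L (k + n) * altProd s L k n

open scoped Classical in
/-- The linear functional with value `y i` on the simple roots `b i` in the `n`-th part, and `0`
on the others. -/
def partWeight {ι : Type*} (b : Module.Basis ι ℝ V) (L : ℕ → List ι) (y : ι → ℝ) (n : ℕ) :
    V →ₗ[ℝ] ℝ :=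
  b.constr ℝ fun i => if i ∈ L n then y i else 0

namespace IsSimpleSystem

variable {ι : Type*} {Φ : Set V} {b : Module.Basis ι ℝ V} {s : ι → V ≃ₗᵢ[ℝ] V}

theorem inner_self_pos (i : ι) : 0 < ⟪b i, b i⟫ :=
  real_inner_self_pos.2 (b.ne_zero i)

theorem repr_nonpos (H : IsSimpleSystem Φ b s) {β : V} (hβ : β ∈ Φ)
    (h : β ∉ positiveRoots Φ b) (i : ι) : b.repr β i ≤ 0 :=
  (H.repr_sign β hβ).resolve_left (fun h' => h ⟨hβ, h'⟩) i

theorem mem_positiveRoots_of_repr_pos (H : IsSimpleSystem Φ b s) {β : V} (hβ : β ∈ Φ) {i : ι}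
    (h : 0 < b.repr β i) : β ∈ positiveRoots Φ b := by
  by_contra hn
  exact absurd (H.repr_nonpos hβ hn i) (not_le.2 h)

theorem exists_repr_pos (H : IsSimpleSystem Φ b s) {β : V} (hβ : β ∈ positiveRoots Φ b) :
    ∃ i, 0 < b.repr β i := by
  by_contra! h
  have : b.repr β = 0 := by
    ext i
    exact le_antisymm (h i) (hβ.2 i)
  rw [LinearEquiv.map_eq_zero_iff] at this
  exact H.zero_notMem (this ▸ hβ.1)

theorem neg_mem_positiveRoots (H : IsSimpleSystem Φ b s) {β : V} (hβ : β ∈ Φ)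
    (h : β ∉ positiveRoots Φ b) : -β ∈ positiveRoots Φ b :=
  ⟨H.neg_mem β hβ, fun i => by simpa using H.repr_nonpos hβ h i⟩

theorem neg_notMem_positiveRoots (H : IsSimpleSystem Φ b s) {β : V}
    (h : β ∈ positiveRoots Φ b) : -β ∉ positiveRoots Φ b := by
  intro hn
  obtain ⟨i, hi⟩ := H.exists_repr_pos h
  have := hn.2 i
  simp only [map_neg, Finsupp.neg_apply] at this
  linarith

theorem simple_mem_positiveRoots (H : IsSimpleSystem Φ b s) (i : ι) :
    b i ∈ positiveRoots Φ b := by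
  classical
  refine ⟨H.simple_mem i, fun j => ?_⟩
  rw [b.repr_self, Finsupp.single_apply]
  split_ifs <;> norm_num

theorem refl_self (H : IsSimpleSystem Φ b s) (i : ι) : s i (b i) = -b i := by
  rw [H.refl_apply, mul_div_assoc, div_self (inner_self_pos i).ne']
  module

theorem refl_refl (H : IsSimpleSystem Φ b s) (i : ι) (v : V) : s i (s i v) = v := by
  conv_lhs => rw [H.refl_apply i v, map_sub, map_smul, H.refl_self, H.refl_apply]
  module

theorem refl_mul_refl (H : IsSimpleSystem Φ b s) (i : ι) : s i * s i = 1 :=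
  LinearIsometryEquiv.ext (H.refl_refl i)

theorem repr_refl_of_ne (H : IsSimpleSystem Φ b s) {i j : ι} (h : j ≠ i) (v : V) :
    b.repr (s i v) j = b.repr v j := by
  rw [H.refl_apply, map_sub, map_smul, b.repr_self]
  simp [h]

/-- A positive root whose coordinates outside `i` vanish is the simple root `b i`. -/
theorem eq_simple_of_repr_eq_zero (H : IsSimpleSystem Φ b s) {β : V}
    (hβ : β ∈ positiveRoots Φ b) {i : ι} (h : ∀ j, j ≠ i → b.repr β j = 0) : β = b i := by
  have h1 : β = b.repr β i • b i := by
    apply b.repr.injective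
    ext j
    by_cases hj : j = i
    · simp [hj]
    · simp [h j hj, Ne.symm hj]
  have h2 := H.reduced (b i) (H.simple_mem i) (b.repr β i) (h1 ▸ hβ.1)
  have h3 := hβ.2 i
  rcases h2 with h2 | h2
  · rw [h1, h2, one_smul]
  · linarith

theorem refl_mem_positiveRoots (H : IsSimpleSystem Φ b s) {β : V} (hβ : β ∈ positiveRoots Φ b)
    {i : ι} (h : β ≠ b i) : s i β ∈ positiveRoots Φ b := by
  by_contra hn
  refine h (H.eq_simple_of_repr_eq_zero hβ fun j hj => ?_)
  have := H.repr_nonpos (H.refl_mem i β hβ.1) hn j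
  rw [H.repr_refl_of_ne hj] at this
  exact le_antisymm this (hβ.2 j)

theorem prod_mem (H : IsSimpleSystem Φ b s) (l : List ι) {β : V} (hβ : β ∈ Φ) :
    (l.map s).prod β ∈ Φ := by
  induction l with
  | nil => exact hβ
  | cons i l ih => exact H.refl_mem i _ ih

theorem refl_conj (H : IsSimpleSystem Φ b s) (w : V ≃ₗᵢ[ℝ] V) {i j : ι} (h : w (b i) = b j) :
    s j * w = w * s i := by
  ext v
  change s j (w v) = w (s i v)
  rw [H.refl_apply, H.refl_apply, ← h, w.inner_map_map, w.inner_map_map, map_sub, map_smul]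

/-- The exchange condition. -/
theorem exchange (H : IsSimpleSystem Φ b s) (i : ι) (l : List ι)
    (h : (l.map s).prod (b i) ∉ positiveRoots Φ b) :
    ∃ l' : List ι, l'.length + 1 = l.length ∧ (l.map s).prod = (l'.map s).prod * s i := by
  induction l with
  | nil => exact absurd (H.simple_mem_positiveRoots i) h
  | cons j l ih =>
    by_cases hl : (l.map s).prod (b i) ∈ positiveRoots Φ b
    · have hj : (l.map s).prod (b i) = b j := by
        by_contra hne
        exact h (H.refl_mem_positiveRoots hl hne)
      exact ⟨l, rfl, by rw [List.map_cons, List.prod_cons, H.refl_conj _ hj]⟩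
    · obtain ⟨l', hlen, hprod⟩ := ih hl
      exact ⟨j :: l', by simp [hlen], by
        rw [List.map_cons, List.prod_cons, hprod, List.map_cons, List.prod_cons, mul_assoc]⟩

theorem exists_word (H : IsSimpleSystem Φ b s) {w : V ≃ₗᵢ[ℝ] V}
    (hw : w ∈ Subgroup.closure (Set.range s)) : ∃ l : List ι, (l.map s).prod = w := by
  induction hw using Subgroup.closure_induction'' with
  | mem x hx =>
    obtain ⟨i, rfl⟩ := hx
    exact ⟨[i], by simp⟩
  | inv_mem x hx =>
    obtain ⟨i, rfl⟩ := hx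
    exact ⟨[i], by simpa using eq_inv_of_mul_eq_one_left (H.refl_mul_refl i)⟩
  | one => exact ⟨[], rfl⟩
  | mul x y _ _ hx hy =>
    obtain ⟨l, rfl⟩ := hx
    obtain ⟨l', rfl⟩ := hy
    exact ⟨l ++ l', by simp⟩

theorem prod_mem_closure (l : List ι) : (l.map s).prod ∈ Subgroup.closure (Set.range s) := by
  refine Subgroup.list_prod_mem _ fun x hx => ?_
  obtain ⟨i, _, rfl⟩ := List.mem_map.1 hx
  exact Subgroup.subset_closure ⟨i, rfl⟩

theorem map_mem (H : IsSimpleSystem Φ b s) {w : V ≃ₗᵢ[ℝ] V}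
    (hw : w ∈ Subgroup.closure (Set.range s)) {β : V} (hβ : β ∈ Φ) : w β ∈ Φ := by
  obtain ⟨l, rfl⟩ := H.exists_word hw
  exact H.prod_mem l hβ

theorem eq_one_of_forall_mem_positiveRoots (H : IsSimpleSystem Φ b s) {w : V ≃ₗᵢ[ℝ] V}
    (hw : w ∈ Subgroup.closure (Set.range s)) (h : ∀ i, w (b i) ∈ positiveRoots Φ b) :
    w = 1 := by
  classical
  have hex : ∃ k, ∃ l : List ι, l.length = k ∧ (l.map s).prod = w := by
    obtain ⟨l, hl⟩ := H.exists_word hw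
    exact ⟨_, l, rfl, hl⟩
  obtain ⟨l, hlen, hprod⟩ := Nat.find_spec hex
  rcases List.eq_nil_or_concat l with rfl | ⟨l', i, rfl⟩
  · exact hprod.symm
  · exfalso
    have hw' : w = (l'.map s).prod * s i := by simp [← hprod]
    have hneg : (l'.map s).prod (b i) ∉ positiveRoots Φ b := by
      intro hp
      apply H.neg_notMem_positiveRoots hp
      have := h i
      rw [hw'] at this
      change (l'.map s).prod (s i (b i)) ∈ _ at this
      rwa [H.refl_self, map_neg] at this
    obtain ⟨l'', hlen', hprod'⟩ := H.exchange i l' hneg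
    have := Nat.find_min' hex (m := l''.length) ⟨l'', rfl, by
      rw [hw', hprod', mul_assoc, H.refl_mul_refl, mul_one]⟩
    simp only [List.concat_eq_append, List.length_append, List.length_singleton] at hlen
    omega

section Longest

variable {w₀ : V ≃ₗᵢ[ℝ] V}

theorem longest_apply_simple_notMem (H : IsSimpleSystem Φ b s)
    (hmem : w₀ ∈ Subgroup.closure (Set.range s))
    (hmax : ∀ u ∈ Subgroup.closure (Set.range s),
      sInf {k : ℕ | ∃ l : List ι, l.length = k ∧ (l.map s).prod = u} ≤
        sInf {k : ℕ | ∃ l : List ι, l.length = k ∧ (l.map s).prod = w₀}) (i : ι) :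
    w₀ (b i) ∉ positiveRoots Φ b := by
  intro hpos
  have hu : w₀ * s i ∈ Subgroup.closure (Set.range s) :=
    mul_mem hmem (Subgroup.subset_closure ⟨i, rfl⟩)
  have hne : {k : ℕ | ∃ l : List ι, l.length = k ∧ (l.map s).prod = w₀ * s i}.Nonempty := by
    obtain ⟨l, hl⟩ := H.exists_word hu
    exact ⟨_, l, rfl, hl⟩
  obtain ⟨l, hlen, hprod⟩ := Nat.sInf_mem hne
  have hneg : (l.map s).prod (b i) ∉ positiveRoots Φ b := by
    rw [hprod]
    change w₀ (s i (b i)) ∉ _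
    rw [H.refl_self, map_neg]
    exact H.neg_notMem_positiveRoots hpos
  obtain ⟨l', hlen', hprod'⟩ := H.exchange i l hneg
  have h1 : (l'.map s).prod = w₀ := mul_right_cancel (hprod'.symm.trans hprod)
  have h2 := Nat.sInf_le (s := {k : ℕ | ∃ l : List ι, l.length = k ∧ (l.map s).prod = w₀})
    ⟨l', rfl, h1⟩
  have h3 := hmax _ hu
  omega

end Longest

section Fintype

variable [Fintype ι]

theorem map_negative (H : IsSimpleSystem Φ b s) {w : V ≃ₗᵢ[ℝ] V}
    (hw : w ∈ Subgroup.closure (Set.range s)) (h : ∀ i, w (b i) ∉ positiveRoots Φ b)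
    {β : V} (hβ : β ∈ positiveRoots Φ b) : w β ∉ positiveRoots Φ b := by
  intro hn
  obtain ⟨i, hi⟩ := H.exists_repr_pos hn
  have hsum : b.repr (w β) i = ∑ j, b.repr β j * b.repr (w (b j)) i := by
    conv_lhs => rw [← b.sum_repr β, map_sum, map_sum, Finsupp.finsetSum_apply]
    simp
  rw [hsum] at hi
  refine absurd hi (not_lt.2 (Finset.sum_nonpos fun j _ => ?_))
  exact mul_nonpos_of_nonneg_of_nonpos (hβ.2 j)
    (H.repr_nonpos (H.map_mem hw (H.simple_mem j)) (h j) i)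

/-- An element of the Weyl group is determined by sending all simple roots to negative roots. -/
theorem eq_of_forall_notMem_positiveRoots (H : IsSimpleSystem Φ b s) {u w : V ≃ₗᵢ[ℝ] V}
    (hu : u ∈ Subgroup.closure (Set.range s)) (hw : w ∈ Subgroup.closure (Set.range s))
    (hu' : ∀ i, u (b i) ∉ positiveRoots Φ b) (hw' : ∀ i, w (b i) ∉ positiveRoots Φ b) :
    u = w := by
  have : w⁻¹ * u = 1 := by
    refine H.eq_one_of_forall_mem_positiveRoots (mul_mem (inv_mem hw) hu) fun i => ?_
    by_contra hn
    have h1 : w ((w⁻¹ * u) (b i)) = u (b i) := by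
      change (w * (w⁻¹ * u)) (b i) = _
      rw [mul_inv_cancel_left]
    have hmem := H.map_mem (mul_mem (inv_mem hw) hu) (H.simple_mem i)
    have h2 := H.map_negative hw hw' (H.neg_mem_positiveRoots hmem hn)
    rw [map_neg, h1] at h2
    exact h2 (H.neg_mem_positiveRoots (H.map_mem hu (H.simple_mem i)) (hu' i))
  exact (inv_mul_eq_one.1 this).symm

end Fintype

theorem inner_simple_nonpos (H : IsSimpleSystem Φ b s) {i j : ι} (h : i ≠ j) :
    ⟪b i, b j⟫ ≤ 0 := by
  have hmem : s j (b i) ∈ positiveRoots Φ b :=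
    H.refl_mem_positiveRoots (H.simple_mem_positiveRoots i) (b.injective.ne h)
  have h1 := hmem.2 j
  rw [H.refl_apply, map_sub, map_smul, b.repr_self, b.repr_self] at h1
  simp only [Finsupp.sub_apply, Finsupp.single_eq_of_ne h.symm, Finsupp.smul_apply,
    Finsupp.single_eq_same, smul_eq_mul, mul_one, zero_sub, Left.nonneg_neg_iff] at h1
  rw [div_nonpos_iff] at h1
  have := inner_self_pos (b := b) j
  rcases h1 with h1 | h1 <;> linarith

theorem inner_eq_zero_of_commute (H : IsSimpleSystem Φ b s) {i j : ι} (h : i ≠ j)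
    (hc : Commute (s i) (s j)) : ⟪b i, b j⟫ = 0 := by
  have h1 : s i (s j (b i)) = -(s j (b i)) := by
    have : (s i * s j) (b i) = (s j * s i) (b i) := by rw [hc.eq]
    change s i (s j (b i)) = s j (s i (b i)) at this
    rw [this, H.refl_self, map_neg]
  have h2 := congrArg (fun v => b.repr v j) h1
  simp only [H.repr_refl_of_ne h.symm, map_neg, Finsupp.neg_apply] at h2
  have h3 : b.repr (s j (b i)) j = 0 := by linarith
  rw [H.refl_apply, map_sub, map_smul, b.repr_self, b.repr_self] at h3
  simp only [Finsupp.sub_apply, Finsupp.single_eq_of_ne h.symm, Finsupp.smul_apply,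
    Finsupp.single_eq_same, smul_eq_mul, mul_one, zero_sub, neg_eq_zero, div_eq_zero_iff] at h3
  have := inner_self_pos (b := b) j
  rcases h3 with h3 | h3 <;> linarith

section Fintype

variable [Fintype ι]

theorem inner_eq_sum_repr (b : Module.Basis ι ℝ V) (v w : V) :
    ⟪v, w⟫ = ∑ i, b.repr v i * ⟪b i, w⟫ := by
  conv_lhs => rw [← b.sum_repr v, sum_inner]
  simp only [real_inner_smul_left]

theorem exists_inner_simple_pos (H : IsSimpleSystem Φ b s) {β : V}
    (hβ : β ∈ positiveRoots Φ b) : ∃ i, 0 < b.repr β i ∧ 0 < ⟪β, b i⟫ := by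
  by_contra! h
  have h0 : β ≠ 0 := fun h0 => H.zero_notMem (h0 ▸ hβ.1)
  refine absurd (real_inner_self_pos.2 h0) (not_lt.2 ?_)
  rw [inner_eq_sum_repr b]
  refine Finset.sum_nonpos fun i _ => ?_
  rcases (hβ.2 i).eq_or_lt with hi | hi
  · simp [← hi]
  · rw [real_inner_comm]
    exact mul_nonpos_of_nonneg_of_nonpos hi.le (h i hi)

/-- The Dynkin diagram of an irreducible root system is connected. -/
theorem connected (H : IsSimpleSystem Φ b s) (Z : Set ι)
    (hZ : ∀ i ∈ Z, ∀ j ∉ Z, ⟪b i, b j⟫ = 0) : Z = ∅ ∨ Z = Set.univ := by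
  have horth : ∀ (Y : Set ι), (∀ i ∈ Y, ∀ j ∉ Y, ⟪b i, b j⟫ = 0) → ∀ v : V,
      (∀ j ∉ Y, b.repr v j = 0) → ∀ i ∉ Y, ⟪v, b i⟫ = 0 := by
    intro Y hY v hv i hi
    rw [inner_eq_sum_repr b]
    refine Finset.sum_eq_zero fun j _ => ?_
    by_cases hj : j ∈ Y
    · rw [hY j hj i hi, mul_zero]
    · rw [hv j hj, zero_mul]
  have hstep : ∀ (Y : Set ι), (∀ i ∈ Y, ∀ j ∉ Y, ⟪b i, b j⟫ = 0) → ∀ (v : V) (i : ι),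
      (∀ j ∉ Y, b.repr (s i v) j = 0) → ∀ j ∉ Y, b.repr v j = 0 := by
    intro Y hY v i hv j hj
    by_cases hi : i ∈ Y
    · rw [← H.repr_refl_of_ne (i := i) (ne_of_mem_of_not_mem hi hj).symm]
      exact hv j hj
    · have h1 := horth Y hY _ hv i hi
      have h2 : s i (s i v) = s i v := by
        conv_lhs => rw [H.refl_apply, h1]
        simp
      rw [← h2, H.refl_refl] at hv
      exact hv j hj
  have hZc : ∀ i ∈ Zᶜ, ∀ j ∉ Zᶜ, ⟪b i, b j⟫ = 0 := by
    intro i hi j hj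
    rw [real_inner_comm]
    exact hZ j (Set.notMem_compl_iff.1 hj) i hi
  have hpos : ∀ β ∈ positiveRoots Φ b,
      (∀ j ∉ Z, b.repr β j = 0) ∨ (∀ j ∉ Zᶜ, b.repr β j = 0) := by
    by_contra! hbad
    let B : Set V := {β ∈ positiveRoots Φ b |
      ¬((∀ j ∉ Z, b.repr β j = 0) ∨ (∀ j ∉ Zᶜ, b.repr β j = 0))}
    have hBfin : B.Finite := H.finite.subset fun β hβ => hβ.1.1
    have hBne : B.Nonempty := by
      obtain ⟨β, hβ, h1, h2⟩ := hbad
      refine ⟨β, hβ, ?_⟩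
      push Not
      exact ⟨h1, h2⟩
    obtain ⟨β, hβ, hmin⟩ := Set.exists_min_image B (fun v => ∑ i, b.repr v i) hBfin hBne
    obtain ⟨i, _, hi⟩ := H.exists_inner_simple_pos hβ.1
    have hne : β ≠ b i := by
      rintro rfl
      apply hβ.2
      by_cases hiZ : i ∈ Z
      · left
        intro j hj
        rw [b.repr_self, Finsupp.single_eq_of_ne (ne_of_mem_of_not_mem hiZ hj).symm]
      · right
        intro j hj
        rw [b.repr_self, Finsupp.single_eq_of_ne (ne_of_mem_of_not_mem hiZ hj).symm]
    have hγ : s i β ∉ B := by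
      intro hγ
      refine absurd (hmin _ hγ) (not_le.2 ?_)
      have hc : 0 < 2 * ⟪β, b i⟫ / ⟪b i, b i⟫ := by
        have := inner_self_pos (b := b) i
        positivity
      have hs : ∑ j, b.repr (b i) j = 1 := by
        classical
        rw [b.repr_self]
        simp [Finsupp.single_apply]
      simp only [H.refl_apply, map_sub, map_smul, Finsupp.sub_apply, Finsupp.smul_apply,
        smul_eq_mul, Finset.sum_sub_distrib, ← Finset.mul_sum, hs]
      linarith
    have hγ' : (∀ j ∉ Z, b.repr (s i β) j = 0) ∨ (∀ j ∉ Zᶜ, b.repr (s i β) j = 0) := by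
      by_contra hn
      exact hγ ⟨H.refl_mem_positiveRoots hβ.1 hne, hn⟩
    exact hβ.2 (hγ'.imp (hstep Z hZ β i) (hstep Zᶜ hZc β i))
  have hall : ∀ β ∈ Φ, (∀ j ∉ Z, b.repr β j = 0) ∨ (∀ j ∉ Zᶜ, b.repr β j = 0) := by
    intro β hβ
    by_cases h : β ∈ positiveRoots Φ b
    · exact hpos β h
    · simpa using hpos _ (H.neg_mem_positiveRoots hβ h)
  by_contra! hne
  obtain ⟨⟨i, hi⟩, hne⟩ := hne
  obtain ⟨j, hj⟩ := (Set.ne_univ_iff_exists_notMem Z).1 hne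
  refine H.irreducible {β ∈ Φ | ∀ j ∉ Z, b.repr β j = 0} {β ∈ Φ | ∀ j ∉ Zᶜ, b.repr β j = 0}
    ⟨b i, H.simple_mem i, ?_⟩ ⟨b j, H.simple_mem j, ?_⟩ ?_ ?_
  · intro k hk
    rw [b.repr_self, Finsupp.single_eq_of_ne (ne_of_mem_of_not_mem hi hk).symm]
  · intro k hk
    rw [b.repr_self, Finsupp.single_eq_of_ne (ne_of_mem_of_not_mem hj hk).symm]
  · ext β
    constructor
    · rintro (h | h) <;> exact h.1
    · intro h
      exact (hall β h).imp (fun h' => ⟨h, h'⟩) (fun h' => ⟨h, h'⟩)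
  · intro v hv w hw
    rw [real_inner_comm, inner_eq_sum_repr b]
    refine Finset.sum_eq_zero fun k _ => ?_
    by_cases hk : k ∈ Z
    · rw [hw.2 k (by simpa using hk), zero_mul]
    · rw [real_inner_comm, horth Z hZ v hv.2 k hk, mul_zero]

/-- A Perron–Frobenius eigenvector of the Cartan matrix. -/
theorem exists_pos_cartan_eigenvector [Nonempty ι] (H : IsSimpleSystem Φ b s) :
    ∃ (y : ι → ℝ) (r : ℝ), (∀ i, 0 < y i) ∧
      ∀ j, ∑ i, 2 * ⟪b j, b i⟫ / ⟪b i, b i⟫ * y i = (2 - r) * y j := by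
  have hnorm : ∀ i, 0 < ‖b i‖ := fun i => norm_pos_iff.2 (b.ne_zero i)
  obtain ⟨x, μ, hx, heig⟩ := Matrix.exists_pos_eigenvector
    (Matrix.of fun i j => ⟪b i, b j⟫ / (‖b i‖ * ‖b j‖))
    (by
      ext i j
      simp [real_inner_comm, mul_comm])
    (fun i j hij => div_nonpos_of_nonpos_of_nonneg (H.inner_simple_nonpos hij)
      (mul_nonneg (hnorm i).le (hnorm j).le))
    (fun Z hZ => H.connected Z fun i hi j hj => by
      have := hZ i hi j hj
      simpa [(hnorm i).ne', (hnorm j).ne', b.ne_zero] using this)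
  refine ⟨fun i => ‖b i‖ * x i, 2 - 2 * μ, fun i => mul_pos (hnorm i) (hx i), fun j => ?_⟩
  have h := heig j
  simp only [Matrix.of_apply] at h
  calc ∑ i, 2 * ⟪b j, b i⟫ / ⟪b i, b i⟫ * (‖b i‖ * x i)
      = 2 * ‖b j‖ * ∑ i, ⟪b j, b i⟫ / (‖b j‖ * ‖b i‖) * x i := by
        rw [Finset.mul_sum]
        refine Finset.sum_congr rfl fun i _ => ?_
        have h1 := (hnorm i).ne'
        have h2 := (hnorm j).ne'
        rw [real_inner_self_eq_norm_sq]
        field_simp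
    _ = (2 - (2 - 2 * μ)) * (‖b j‖ * x j) := by rw [h]; ring

end Fintype

theorem prod_apply_of_orthogonal (H : IsSimpleSystem Φ b s) (v : V) (l : List ι) (hl : l.Nodup)
    (h : ∀ i ∈ l, ∀ j ∈ l, i ≠ j → ⟪b i, b j⟫ = 0) :
    (l.map s).prod v = v - (l.map fun i => (2 * ⟪v, b i⟫ / ⟪b i, b i⟫) • b i).sum := by
  have hfix : ∀ (i : ι) (l : List ι), (∀ j ∈ l, ⟪b j, b i⟫ = 0) →
      s i ((l.map fun i => (2 * ⟪v, b i⟫ / ⟪b i, b i⟫) • b i).sum) =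
        (l.map fun i => (2 * ⟪v, b i⟫ / ⟪b i, b i⟫) • b i).sum := by
    intro i l hl
    induction l with
    | nil => simp
    | cons j l ih =>
      have hj : s i (b j) = b j := by
        rw [H.refl_apply, hl j (by simp)]
        simp
      rw [List.map_cons, List.sum_cons, map_add, map_smul, hj,
        ih fun k hk => hl k (List.mem_cons_of_mem _ hk)]
  induction l with
  | nil => simp
  | cons i l ih =>
    obtain ⟨hil, hl'⟩ := List.nodup_cons.1 hl
    have ih' := ih hl' fun j hj k hk =>
      h j (List.mem_cons_of_mem _ hj) k (List.mem_cons_of_mem _ hk)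
    rw [List.map_cons, List.prod_cons, List.map_cons, List.sum_cons]
    change s i ((l.map s).prod v) = _
    rw [ih', map_sub, hfix i l fun j hj => h j (List.mem_cons_of_mem _ hj) i (by simp)
      (ne_of_mem_of_not_mem hj hil), H.refl_apply]
    abel

section Bipartition

variable {L : ℕ → List ι}

theorem _root_.IsBipartition.eq_of_mod_two (hL : IsBipartition b L) {m n : ℕ}
    (h : m % 2 = n % 2) :
    L m = L n :=
  apply_eq_of_mod_two hL.periodic h

theorem partProd_congr (hL : IsBipartition b L) {m n : ℕ} (h : m % 2 = n % 2) :
    partProd s L m = partProd s L n := by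
  rw [partProd, partProd, hL.eq_of_mod_two h]

theorem altProd_congr (hL : IsBipartition b L) {k l : ℕ} (h : k % 2 = l % 2) (n : ℕ) :
    altProd s L k n = altProd s L l n := by
  induction n with
  | zero => rfl
  | succ n ih =>
    rw [altProd, altProd, ih, partProd_congr hL (show (k + n) % 2 = (l + n) % 2 by omega)]

theorem altProd_add (k m n : ℕ) :
    altProd s L k (m + n) = altProd s L (k + m) n * altProd s L k m := by
  induction n with
  | zero => simp [altProd]
  | succ n ih => rw [← add_assoc, altProd, ih, altProd, mul_assoc, add_assoc]

theorem altProd_two_mul (hL : IsBipartition b L) (k n : ℕ) :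
    altProd s L k (2 * n) = (partProd s L (k + 1) * partProd s L k) ^ n := by
  induction n with
  | zero => rfl
  | succ n ih =>
    rw [mul_add, add_comm, mul_one, altProd_add,
      altProd_congr hL (show (k + 2) % 2 = k % 2 by omega), ih, pow_succ]
    simp [altProd]

theorem partProd_mem (n : ℕ) : partProd s L n ∈ Subgroup.closure (Set.range s) :=
  prod_mem_closure _

theorem altProd_mem (k n : ℕ) : altProd s L k n ∈ Subgroup.closure (Set.range s) := by
  induction n with
  | zero => exact one_mem _
  | succ n ih => exact mul_mem (partProd_mem _) ih

theorem partProd_apply [DecidableEq ι] (H : IsSimpleSystem Φ b s) (hL : IsBipartition b L)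
    (n : ℕ) (v : V) :
    partProd s L n v = v - ∑ i ∈ (L n).toFinset, (2 * ⟪v, b i⟫ / ⟪b i, b i⟫) • b i := by
  rw [partProd, H.prod_apply_of_orthogonal v (L n) (hL.nodup n) (hL.orthogonal n),
    List.sum_toFinset _ (hL.nodup n)]

theorem partProd_simple (H : IsSimpleSystem Φ b s) (hL : IsBipartition b L) {n : ℕ} {i : ι}
    (hi : i ∈ L n) : partProd s L n (b i) = -b i := by
  classical
  rw [partProd_apply H hL, Finset.sum_eq_single_of_mem i (List.mem_toFinset.2 hi), mul_div_assoc,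
    div_self (inner_self_pos i).ne']
  · module
  · intro j hj hji
    rw [hL.orthogonal n i hi j (List.mem_toFinset.1 hj) hji.symm]
    simp

theorem partProd_partProd (H : IsSimpleSystem Φ b s) (hL : IsBipartition b L) (n : ℕ) (v : V) :
    partProd s L n (partProd s L n v) = v := by
  classical
  conv_lhs => rw [partProd_apply H hL n v, map_sub, map_sum, partProd_apply H hL n v]
  have : ∀ i ∈ (L n).toFinset, partProd s L n ((2 * ⟪v, b i⟫ / ⟪b i, b i⟫) • b i) =
      -((2 * ⟪v, b i⟫ / ⟪b i, b i⟫) • b i) := by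
    intro i hi
    rw [map_smul, partProd_simple H hL (List.mem_toFinset.1 hi), smul_neg]
  rw [Finset.sum_congr rfl this, Finset.sum_neg_distrib]
  abel

theorem repr_partProd_of_notMem (H : IsSimpleSystem Φ b s) (hL : IsBipartition b L) {n : ℕ}
    {i : ι} (hi : i ∉ L n) (v : V) : b.repr (partProd s L n v) i = b.repr v i := by
  classical
  rw [partProd_apply H hL, map_sub, map_sum, Finsupp.sub_apply, Finsupp.finsetSum_apply,
    Finset.sum_eq_zero, sub_zero]
  intro j hj
  rw [map_smul, b.repr_self, Finsupp.smul_apply,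
    Finsupp.single_eq_of_ne (ne_of_mem_of_not_mem (List.mem_toFinset.1 hj) hi).symm, smul_zero]

theorem exists_mem_part (hL : IsBipartition b L) (i : ι) : ∃ k, i ∈ L (k + 1) := by
  by_cases h : i ∈ L 1
  · exact ⟨0, h⟩
  · exact ⟨1, (hL.mem_succ_iff 1 i).2 h⟩

theorem altProd_simple_notMem {m : ℕ} (H : IsSimpleSystem Φ b s) (hL : IsBipartition b L) (hm0 : 0 < m)
    (hpos : ∀ k i, i ∈ L (k + 1) → ∀ n < m, altProd s L k n (b i) ∈ positiveRoots Φ b)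
    (hneg : ∀ k i, i ∈ L (k + 1) → ∃ j ∈ L (k + m + 1), altProd s L k m (b i) = -b j)
    (k : ℕ) (i : ι) : altProd s L k m (b i) ∉ positiveRoots Φ b := by
  by_cases hi : i ∈ L (k + 1)
  · obtain ⟨j, _, hj⟩ := hneg k i hi
    rw [hj]
    exact H.neg_notMem_positiveRoots (H.simple_mem_positiveRoots j)
  · obtain ⟨n, rfl⟩ : ∃ n, m = 1 + n := ⟨m - 1, by omega⟩
    have hik : i ∈ L k := by
      by_contra h
      exact hi ((hL.mem_succ_iff k i).2 h)
    have h1 := hpos (k + 1) i (by rwa [hL.periodic]) n (by omega)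
    rw [altProd_add]
    change altProd s L (k + 1) n (partProd s L k (b i)) ∉ _
    rw [partProd_simple H hL hik, map_neg]
    exact H.neg_notMem_positiveRoots h1

theorem exists_eq_simple [Fintype ι] (H : IsSimpleSystem Φ b s) (hL : IsBipartition b L) {n : ℕ}
    {β : V} (hβ : β ∈ positiveRoots Φ b) (h : ∀ j ∉ L n, b.repr β j = 0) :
    ∃ i ∈ L n, β = b i := by
  obtain ⟨i, hi, _⟩ := H.exists_inner_simple_pos hβ
  have hiL : i ∈ L n := by
    by_contra hn
    exact hi.ne' (h i hn)
  have hinner : ⟪β, b i⟫ = b.repr β i * ⟪b i, b i⟫ := by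
    rw [inner_eq_sum_repr b]
    refine Finset.sum_eq_single i (fun j _ hj => ?_) (by simp)
    by_cases hjL : j ∈ L n
    · rw [hL.orthogonal n j hjL i hiL hj, mul_zero]
    · rw [h j hjL, zero_mul]
  have hneg : s i β ∉ positiveRoots Φ b := by
    intro hp
    have := hp.2 i
    rw [H.refl_apply, hinner, ← mul_assoc, mul_div_assoc,
      div_self (inner_self_pos i).ne'] at this
    simp only [mul_one, map_sub, map_smul, b.repr_self, Finsupp.sub_apply, Finsupp.smul_apply,
      Finsupp.single_eq_same, smul_eq_mul] at this
    linarith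
  refine ⟨i, hiL, ?_⟩
  by_contra hne
  exact hneg (H.refl_mem_positiveRoots hβ hne)

theorem partProd_mem_positiveRoots [Fintype ι] (H : IsSimpleSystem Φ b s)
    (hL : IsBipartition b L) {n : ℕ} {β : V} (hβ : β ∈ positiveRoots Φ b)
    (h : ¬∃ i ∈ L n, β = b i) : partProd s L n β ∈ positiveRoots Φ b := by
  have : ∃ j ∉ L n, b.repr β j ≠ 0 := by
    by_contra! hn
    exact h (exists_eq_simple H hL hβ hn)
  obtain ⟨j, hj, hne⟩ := this
  refine H.mem_positiveRoots_of_repr_pos (H.map_mem (partProd_mem n) hβ.1) (i := j) ?_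
  rw [repr_partProd_of_notMem H hL hj]
  exact lt_of_le_of_ne (hβ.2 j) hne.symm

end Bipartition

section Weight

variable {L : ℕ → List ι} {y : ι → ℝ} {r : ℝ}

theorem partWeight_simple_of_mem {n : ℕ} {i : ι} (h : i ∈ L n) :
    partWeight b L y n (b i) = y i := by
  simp [partWeight, Module.Basis.constr_basis, h]

theorem partWeight_simple_of_notMem {n : ℕ} {i : ι} (h : i ∉ L n) :
    partWeight b L y n (b i) = 0 := by
  simp [partWeight, Module.Basis.constr_basis, h]

theorem partWeight_congr (hL : IsBipartition b L) {m n : ℕ} (h : m % 2 = n % 2) :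
    partWeight b L y m = partWeight b L y n := by
  rw [partWeight, partWeight, hL.eq_of_mod_two h]

theorem partWeight_succ_partProd (H : IsSimpleSystem Φ b s) (hL : IsBipartition b L) (n : ℕ)
    (v : V) : partWeight b L y (n + 1) (partProd s L n v) = partWeight b L y (n + 1) v := by
  classical
  rw [partProd_apply H hL, map_sub, map_sum, Finset.sum_eq_zero, sub_zero]
  intro i hi
  have hi' : i ∉ L (n + 1) := by
    rw [hL.mem_succ_iff, not_not]
    exact List.mem_toFinset.1 hi
  rw [map_smul, partWeight_simple_of_notMem hi', smul_zero]

variable [Fintype ι]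

theorem partWeight_partProd (H : IsSimpleSystem Φ b s) (hL : IsBipartition b L)
    (hy : ∀ j, ∑ i, 2 * ⟪b j, b i⟫ / ⟪b i, b i⟫ * y i = (2 - r) * y j) (n : ℕ) (v : V) :
    partWeight b L y n (partProd s L n v) =
      r * partWeight b L y (n + 1) v - partWeight b L y n v := by
  classical
  suffices h : (partWeight b L y n) ∘ₗ (partProd s L n).toLinearEquiv.toLinearMap =
      r • partWeight b L y (n + 1) - partWeight b L y n from LinearMap.congr_fun h v
  refine b.ext fun j => ?_
  change partWeight b L y n (partProd s L n (b j)) =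
    r * partWeight b L y (n + 1) (b j) - partWeight b L y n (b j)
  by_cases hj : j ∈ L n
  · have hj' : j ∉ L (n + 1) := by rwa [hL.mem_succ_iff, not_not]
    rw [partProd_simple H hL hj, map_neg, partWeight_simple_of_notMem hj']
    ring
  · have hj' : j ∈ L (n + 1) := by rwa [hL.mem_succ_iff]
    rw [partWeight_simple_of_mem hj', partWeight_simple_of_notMem hj, partProd_apply H hL,
      map_sub, map_sum, partWeight_simple_of_notMem hj]
    have h1 : ∀ i ∈ (L n).toFinset,
        partWeight b L y n ((2 * ⟪b j, b i⟫ / ⟪b i, b i⟫) • b i) =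
          2 * ⟪b j, b i⟫ / ⟪b i, b i⟫ * y i := by
      intro i hi
      rw [map_smul, partWeight_simple_of_mem (List.mem_toFinset.1 hi), smul_eq_mul]
    rw [Finset.sum_congr rfl h1]
    have h2 := Finset.sum_add_sum_compl (L n).toFinset
      fun i => 2 * ⟪b j, b i⟫ / ⟪b i, b i⟫ * y i
    rw [hy j, Finset.sum_eq_single_of_mem (s := (L n).toFinsetᶜ) j
      (by simpa using hj), mul_div_assoc, div_self (inner_self_pos j).ne'] at h2
    · linarith
    · intro i hi hij
      have hi' : i ∈ L (n + 1) := by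
        rw [hL.mem_succ_iff]
        simpa using hi
      rw [hL.orthogonal (n + 1) j hj' i hi' hij.symm]
      simp

theorem partWeight_apply_eq_sum [DecidableEq ι] (n : ℕ) (v : V) :
    partWeight b L y n v = ∑ i, b.repr v i * if i ∈ L n then y i else 0 := by
  rw [partWeight, Module.Basis.constr_apply_fintype]
  refine Finset.sum_congr rfl fun i _ => ?_
  rw [b.equivFun_apply, smul_eq_mul]
  congr

/-- A positive root on which the weight of one part vanishes is a simple root in the other. -/
theorem exists_eq_simple_of_partWeight_eq_zero (H : IsSimpleSystem Φ b s)
    (hL : IsBipartition b L) (hy : ∀ i, 0 < y i) {n : ℕ} {β : V}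
    (hβ : β ∈ positiveRoots Φ b) (h : partWeight b L y (n + 1) β = 0) :
    ∃ i ∈ L n, β = b i := by
  classical
  refine exists_eq_simple H hL hβ fun j hj => ?_
  rw [partWeight_apply_eq_sum, Finset.sum_eq_zero_iff_of_nonneg] at h
  · have := h j (Finset.mem_univ j)
    rw [if_pos ((hL.mem_succ_iff n j).2 hj)] at this
    exact (mul_eq_zero.1 this).resolve_right (hy j).ne'
  · intro i _
    refine mul_nonneg (hβ.2 i) ?_
    split_ifs
    · exact (hy i).le
    · exact le_rfl

end Weight

/-- The sequence `0, 1, r, r ^ 2 - 1, …` of values at `r` of rescaled Chebyshev polynomials of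
the second kind. -/
def chebyshevSeq (r : ℝ) : ℕ → ℝ
  | 0 => 0
  | 1 => 1
  | n + 2 => r * chebyshevSeq r (n + 1) - chebyshevSeq r n

section Period

variable [Fintype ι] {L : ℕ → List ι} {y : ι → ℝ} {r : ℝ}

theorem partWeight_altProd (H : IsSimpleSystem Φ b s) (hL : IsBipartition b L)
    (heig : ∀ j, ∑ i, 2 * ⟪b j, b i⟫ / ⟪b i, b i⟫ * y i = (2 - r) * y j) {k : ℕ} {i : ι}
    (hi : i ∈ L (k + 1)) (n : ℕ) :
    partWeight b L y (k + n) (altProd s L k n (b i)) = y i * chebyshevSeq r n ∧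
      partWeight b L y (k + n + 1) (altProd s L k n (b i)) = y i * chebyshevSeq r (n + 1) := by
  induction n with
  | zero =>
    have hi' : i ∉ L k := (hL.mem_succ_iff k i).1 hi
    simp [altProd, chebyshevSeq, partWeight_simple_of_mem hi, partWeight_simple_of_notMem hi']
  | succ n ih =>
    obtain ⟨h1, h2⟩ := ih
    change partWeight b L y (k + n + 1) (partProd s L (k + n) (altProd s L k n (b i))) = _ ∧
      partWeight b L y (k + n + 2) (partProd s L (k + n) (altProd s L k n (b i))) = _
    refine ⟨by rw [partWeight_succ_partProd H hL, h2], ?_⟩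
    rw [partWeight_congr hL (show (k + n + 2) % 2 = (k + n) % 2 by omega),
      partWeight_partProd H hL heig, h1, h2, chebyshevSeq]
    ring

theorem exists_chebyshevSeq_eq_zero [Nonempty ι] (H : IsSimpleSystem Φ b s)
    (hL : IsBipartition b L) (hy : ∀ i, 0 < y i)
    (heig : ∀ j, ∑ i, 2 * ⟪b j, b i⟫ / ⟪b i, b i⟫ * y i = (2 - r) * y j) :
    ∃ m, 0 < m ∧ chebyshevSeq r m = 0 := by
  obtain ⟨i⟩ := ‹Nonempty ι›
  obtain ⟨k, hi⟩ := exists_mem_part hL i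
  have : Finite Φ := H.finite
  obtain ⟨n, n', hne, heq⟩ := Finite.exists_ne_map_eq_of_infinite
    fun n : ℕ => (⟨altProd s L k (2 * n) (b i), H.map_mem (altProd_mem k _) (H.simple_mem i)⟩ : Φ)
  simp only [Subtype.mk.injEq] at heq
  wlog hlt : n < n' generalizing n n'
  · exact this n' n hne.symm heq.symm (by omega)
  obtain ⟨d, rfl⟩ := Nat.exists_eq_add_of_lt hlt
  have hd : altProd s L k (2 * (d + 1)) (b i) = b i := by
    rw [altProd_two_mul hL, altProd_two_mul hL, add_assoc, pow_add] at heq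
    rw [altProd_two_mul hL]
    exact ((LinearIsometryEquiv.injective _) heq).symm
  have h1 := (partWeight_altProd H hL heig hi (2 * (d + 1))).1
  rw [hd, partWeight_congr hL (show (k + 2 * (d + 1)) % 2 = k % 2 by omega),
    partWeight_simple_of_notMem ((hL.mem_succ_iff k i).1 hi)] at h1
  exact ⟨2 * (d + 1), by omega, (mul_eq_zero.1 h1.symm).resolve_left (hy i).ne'⟩

/-- The alternating walks starting at simple roots stay positive for a number of steps which does
not depend on the simple root, and then reach a negative simple root. -/
theorem exists_period [Nonempty ι] (H : IsSimpleSystem Φ b s) (hL : IsBipartition b L) :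
    ∃ m, 0 < m ∧ ∀ k i, i ∈ L (k + 1) →
      (∀ n < m, altProd s L k n (b i) ∈ positiveRoots Φ b) ∧
      (∃ j ∈ L (k + m + 1), altProd s L k m (b i) = -b j) ∧
      (∀ n, 0 < n → n < m → altProd s L k (2 * n) (b i) ≠ b i) := by
  classical
  obtain ⟨y, r, hy, heig⟩ := H.exists_pos_cartan_eigenvector
  have hex := exists_chebyshevSeq_eq_zero H hL hy heig
  obtain ⟨hm0, hm⟩ := Nat.find_spec hex
  have hmin : ∀ n, 0 < n → n < Nat.find hex → chebyshevSeq r n ≠ 0 :=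
    fun n hn hlt h => Nat.find_min hex hlt ⟨hn, h⟩
  set m := Nat.find hex
  have hpos : ∀ k i, i ∈ L (k + 1) → ∀ n < m, altProd s L k n (b i) ∈ positiveRoots Φ b := by
    intro k i hi n
    induction n with
    | zero => intro _; exact H.simple_mem_positiveRoots i
    | succ n ih =>
      intro hn
      have hnot : ¬∃ j ∈ L (k + n), altProd s L k n (b i) = b j := by
        rintro ⟨j, hj, heq⟩
        have h1 := (partWeight_altProd H hL heig hi n).2
        have hj' : j ∉ L (k + n + 1) := by rwa [hL.mem_succ_iff, not_not]
        rw [heq, partWeight_simple_of_notMem hj'] at h1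
        exact hmin (n + 1) (by omega) hn ((mul_eq_zero.1 h1.symm).resolve_left (hy i).ne')
      exact partProd_mem_positiveRoots H hL (ih (by omega)) hnot
  have hneg : ∀ k i, i ∈ L (k + 1) → ∃ j ∈ L (k + m + 1), altProd s L k m (b i) = -b j := by
    intro k i hi
    obtain ⟨n, hn⟩ : ∃ n, m = n + 1 := ⟨m - 1, by omega⟩
    have h1 := (partWeight_altProd H hL heig hi n).2
    rw [← hn, hm, mul_zero] at h1
    obtain ⟨j, hj, heq⟩ :=
      exists_eq_simple_of_partWeight_eq_zero H hL hy (hpos k i hi n (by omega)) h1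
    refine ⟨j, ?_, ?_⟩
    · rwa [hL.eq_of_mod_two (show (k + m + 1) % 2 = (k + n) % 2 by omega)]
    · rw [hn]
      change partProd s L (k + n) (altProd s L k n (b i)) = _
      rw [heq, partProd_simple H hL hj]
  refine ⟨m, hm0, fun k i hi => ⟨hpos k i hi, hneg k i hi, fun n hn hnm heq => ?_⟩⟩
  rcases Nat.lt_or_ge (2 * n) m with hlt | hge
  · have h1 := (partWeight_altProd H hL heig hi (2 * n)).1
    rw [heq, partWeight_congr hL (show (k + 2 * n) % 2 = k % 2 by omega),
      partWeight_simple_of_notMem ((hL.mem_succ_iff k i).1 hi)] at h1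
    exact hmin (2 * n) (by omega) hlt ((mul_eq_zero.1 h1.symm).resolve_left (hy i).ne')
  · obtain ⟨d, hd⟩ := Nat.exists_eq_add_of_le hge
    obtain ⟨j, hj, hj'⟩ := hneg k i hi
    rw [hd, altProd_add] at heq
    change altProd s L (k + m) d (altProd s L k m (b i)) = b i at heq
    rw [hj', map_neg] at heq
    have h1 := hpos (k + m) j hj d (by omega)
    have h2 := H.neg_notMem_positiveRoots h1
    rw [heq] at h2
    exact h2 (H.simple_mem_positiveRoots i)

variable {m : ℕ}

theorem orderOf_bipartite_coxeter [Nonempty ι] (H : IsSimpleSystem Φ b s)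
    (hL : IsBipartition b L) (hm0 : 0 < m)
    (hpos : ∀ k i, i ∈ L (k + 1) → ∀ n < m, altProd s L k n (b i) ∈ positiveRoots Φ b)
    (hneg : ∀ k i, i ∈ L (k + 1) → ∃ j ∈ L (k + m + 1), altProd s L k m (b i) = -b j)
    (hne : ∀ k i, i ∈ L (k + 1) → ∀ n, 0 < n → n < m → altProd s L k (2 * n) (b i) ≠ b i) :
    orderOf (partProd s L 1 * partProd s L 0) = m := by
  rw [orderOf_eq_iff hm0]
  constructor
  · have h2 := altProd_two_mul (s := s) hL 0 m
    rw [zero_add] at h2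
    rw [← h2]
    refine H.eq_one_of_forall_mem_positiveRoots (altProd_mem _ _) fun i => ?_
    rw [two_mul, altProd_add]
    change altProd s L (0 + m) m (altProd s L 0 m (b i)) ∈ _
    have h3 : altProd s L 0 m (b i) ∈ Φ := H.map_mem (altProd_mem _ _) (H.simple_mem i)
    have h4 := H.map_negative (altProd_mem (0 + m) m)
      (altProd_simple_notMem H hL hm0 hpos hneg (0 + m))
      (H.neg_mem_positiveRoots h3 (altProd_simple_notMem H hL hm0 hpos hneg 0 i))
    rw [map_neg] at h4
    by_contra hn
    exact h4 (H.neg_mem_positiveRoots (H.map_mem (altProd_mem _ _) h3) hn)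
  · intro n hnm hn heq
    obtain ⟨i⟩ := ‹Nonempty ι›
    by_cases hi : i ∈ L 1
    · have h2 := altProd_two_mul (s := s) hL 0 n
      rw [zero_add, heq] at h2
      exact hne 0 i hi n hn hnm (by rw [h2]; rfl)
    · have hinv : ∀ k, (partProd s L k)⁻¹ = partProd s L k := fun k =>
        inv_eq_of_mul_eq_one_left (LinearIsometryEquiv.ext (partProd_partProd H hL k))
      have h2 := altProd_two_mul (s := s) hL 1 n
      rw [partProd_congr hL (show (1 + 1) % 2 = 0 % 2 by omega), ← hinv 0, ← hinv 1,
        ← mul_inv_rev, inv_pow, heq, inv_one] at h2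
      exact hne 1 i ((hL.mem_succ_iff 1 i).2 hi) n hn hnm (by rw [h2]; rfl)

end Period

section Tau

/-- The map on almost positive roots attached to the `n`-th part. -/
def partTau (s : ι → V ≃ₗᵢ[ℝ] V) (b : Module.Basis ι ℝ V) (L : ℕ → List ι) (n : ℕ) : V → V :=
  tauMap (L (n + 1)) b (partProd s L n)

/-- The positive roots together with the negatives of the simple roots. -/
def almostPositiveRoots (Φ : Set V) (b : Module.Basis ι ℝ V) : Set V :=
  positiveRoots Φ b ∪ {x | ∃ i, x = -b i}

variable {L : ℕ → List ι}

theorem partTau_periodic (hL : IsBipartition b L) (n : ℕ) :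
    partTau s b L (n + 2) = partTau s b L n := by
  rw [partTau, partTau, partProd_congr hL (show (n + 2) % 2 = n % 2 by omega),
    hL.eq_of_mod_two (show (n + 2 + 1) % 2 = (n + 1) % 2 by omega)]

theorem neg_simple_notMem_positiveRoots (H : IsSimpleSystem Φ b s) (i : ι) :
    -b i ∉ positiveRoots Φ b :=
  H.neg_notMem_positiveRoots (H.simple_mem_positiveRoots i)

theorem partTau_of_mem_positiveRoots (H : IsSimpleSystem Φ b s) {β : V}
    (hβ : β ∈ positiveRoots Φ b) (n : ℕ) : partTau s b L n β = partProd s L n β := by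
  refine if_neg ?_
  rintro ⟨i, _, rfl⟩
  exact H.neg_simple_notMem_positiveRoots i hβ

theorem partTau_neg_simple_of_mem_succ {n : ℕ} {i : ι} (hi : i ∈ L (n + 1)) :
    partTau s b L n (-b i) = -b i :=
  if_pos ⟨i, hi, rfl⟩

theorem partTau_neg_simple (H : IsSimpleSystem Φ b s) (hL : IsBipartition b L) {n : ℕ} {i : ι}
    (hi : i ∈ L n) : partTau s b L n (-b i) = b i := by
  have hnot : ¬∃ j ∈ L (n + 1), -b i = -b j := by
    rintro ⟨j, hj, heq⟩
    rw [b.injective (neg_injective heq)] at hi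
    exact (hL.mem_succ_iff n j).1 hj hi
  refine (if_neg hnot).trans ?_
  rw [map_neg, partProd_simple H hL hi, neg_neg]

theorem partTau_simple (H : IsSimpleSystem Φ b s) (hL : IsBipartition b L) {n : ℕ} {i : ι}
    (hi : i ∈ L n) : partTau s b L n (b i) = -b i := by
  rw [H.partTau_of_mem_positiveRoots (H.simple_mem_positiveRoots i), partProd_simple H hL hi]

variable [Fintype ι]

theorem partTau_involutive (H : IsSimpleSystem Φ b s) (hL : IsBipartition b L) (n : ℕ) {β : V}
    (hβ : β ∈ almostPositiveRoots Φ b) :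
    partTau s b L n β ∈ almostPositiveRoots Φ b ∧ partTau s b L n (partTau s b L n β) = β := by
  rcases hβ with hβ | ⟨i, rfl⟩
  · by_cases h : ∃ i ∈ L n, β = b i
    · obtain ⟨i, hi, rfl⟩ := h
      rw [H.partTau_simple hL hi, H.partTau_neg_simple hL hi]
      exact ⟨Or.inr ⟨i, rfl⟩, rfl⟩
    · have h1 := partProd_mem_positiveRoots H hL hβ h
      rw [H.partTau_of_mem_positiveRoots hβ, H.partTau_of_mem_positiveRoots h1,
        partProd_partProd H hL]
      exact ⟨Or.inl h1, rfl⟩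
  · by_cases hi : i ∈ L n
    · rw [H.partTau_neg_simple hL hi, H.partTau_simple hL hi]
      exact ⟨Or.inl (H.simple_mem_positiveRoots i), rfl⟩
    · have hi' := (hL.mem_succ_iff n i).2 hi
      rw [partTau_neg_simple_of_mem_succ hi', partTau_neg_simple_of_mem_succ hi']
      exact ⟨Or.inr ⟨i, rfl⟩, rfl⟩

variable {m : ℕ}

/-- The orbit of a negative simple root. -/
theorem dihedralOrbit_neg_simple (H : IsSimpleSystem Φ b s) (hL : IsBipartition b L)
    (hpos : ∀ k i, i ∈ L (k + 1) → ∀ n < m, altProd s L k n (b i) ∈ positiveRoots Φ b)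
    (hneg : ∀ k i, i ∈ L (k + 1) → ∃ j ∈ L (k + m + 1), altProd s L k m (b i) = -b j)
    {k : ℕ} {i : ι} (hi : i ∈ L (k + 1)) :
    dihedralOrbit (partTau s b L 0) (partTau s b L 1) (-b i) ∩ {x | ∃ i, x = -b i} =
        {-b i, altProd s L k m (b i)} ∧
      (-b i = altProd s L k m (b i) →
        2 * (dihedralOrbit (partTau s b L 0) (partTau s b L 1) (-b i)).ncard = m + 2) ∧
      (-b i ≠ altProd s L k m (b i) →
        (dihedralOrbit (partTau s b L 0) (partTau s b L 1) (-b i)).ncard = m + 2) := by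
  obtain ⟨j, hj, hij⟩ := hneg k i hi
  let x : ℕ → V := fun n => Nat.casesOn n (-b i) fun n => altProd s L k n (b i)
  have ht := partTau_periodic (s := s) hL
  have hstep : ∀ n ≤ m, x (n + 1) = partTau s b L (k + n + 1) (x n) := by
    intro n hn
    cases n with
    | zero => exact (H.partTau_neg_simple hL hi).symm
    | succ n =>
      change partProd s L (k + n) (altProd s L k n (b i)) =
        partTau s b L (k + n + 2) (altProd s L k n (b i))
      rw [ht, H.partTau_of_mem_positiveRoots (hpos k i hi n (by omega))]
  have hmem : ∀ n ≤ m + 1, x n ∈ almostPositiveRoots Φ b := by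
    intro n
    induction n with
    | zero => exact fun _ => Or.inr ⟨i, rfl⟩
    | succ n ih =>
      intro hn
      rw [hstep n (by omega)]
      exact (H.partTau_involutive hL _ (ih (by omega))).1
  have hback : ∀ n ≤ m, x n = partTau s b L (k + n + 1) (x (n + 1)) := by
    intro n hn
    rw [hstep n hn, (H.partTau_involutive hL _ (hmem n (by omega))).2]
  have hend : x (m + 1) = -b j := hij
  have hnot : ∀ n, 1 ≤ n → n ≤ m → x n ∉ {x | ∃ i, x = -b i} := by
    rintro n h1 hn ⟨l, hl⟩
    obtain ⟨n, rfl⟩ : ∃ n', n = n' + 1 := ⟨n - 1, by omega⟩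
    have h2 : x (n + 1) ∈ positiveRoots Φ b := hpos k i hi n (by omega)
    rw [hl] at h2
    exact H.neg_simple_notMem_positiveRoots l h2
  have hpar : m % 2 = 1 → x 0 ≠ x (m + 1) := by
    intro hm heq
    rw [hend] at heq
    rw [b.injective (neg_injective heq)] at hi
    rw [hL.eq_of_mod_two (show (k + m + 1) % 2 = k % 2 by omega)] at hj
    exact (hL.mem_succ_iff k j).1 hi hj
  have hfix : partTau s b L (k + m + 2) (x (m + 1)) = x (m + 1) := by
    rw [hend]
    refine partTau_neg_simple_of_mem_succ ?_
    rwa [hL.eq_of_mod_two (show (k + m + 2 + 1) % 2 = (k + m + 1) % 2 by omega)]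
  have horbit := dihedralOrbit_eq_image_walk ht hstep hback
    (partTau_neg_simple_of_mem_succ hi) hfix
  have hcard := ncard_image_walk ht hstep hback (N := {x | ∃ i, x = -b i}) ⟨i, rfl⟩ ⟨j, hend⟩
    hnot hpar
  rw [← horbit] at hcard
  refine ⟨?_, hcard⟩
  change dihedralOrbit _ _ (x 0) ∩ _ = {x 0, x (m + 1)}
  rw [horbit]
  ext v
  constructor
  · rintro ⟨⟨n, hn, rfl⟩, hv⟩
    rcases Nat.eq_zero_or_pos n with rfl | h0
    · exact Or.inl rfl
    · have hn' : n ≤ m + 1 := hn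
      rcases Nat.lt_or_ge m n with h1 | h1
      · obtain rfl : n = m + 1 := by omega
        exact Or.inr rfl
      · exact (hnot n h0 h1 hv).elim
  · rintro (rfl | rfl)
    · exact ⟨⟨0, Nat.zero_le _, rfl⟩, i, rfl⟩
    · exact ⟨⟨m + 1, Set.mem_Iic.2 le_rfl, rfl⟩, j, hend⟩

theorem exists_neg_simple_mem_dihedralOrbit (H : IsSimpleSystem Φ b s) (hL : IsBipartition b L)
    (hm0 : 0 < m)
    (hpos : ∀ k i, i ∈ L (k + 1) → ∀ n < m, altProd s L k n (b i) ∈ positiveRoots Φ b)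
    (hneg : ∀ k i, i ∈ L (k + 1) → ∃ j ∈ L (k + m + 1), altProd s L k m (b i) = -b j)
    {β : V} (hβ : β ∈ almostPositiveRoots Φ b) :
    ∃ i, -b i ∈ dihedralOrbit (partTau s b L 0) (partTau s b L 1) β := by
  rcases hβ with hβ | ⟨i, rfl⟩
  swap
  · exact ⟨i, Relation.ReflTransGen.refl⟩
  by_contra! hn
  have hclosed : ∀ n x, x ∈ dihedralOrbit (partTau s b L 0) (partTau s b L 1) β →
      partTau s b L n x ∈ dihedralOrbit (partTau s b L 0) (partTau s b L 1) β := by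
    intro n x hx
    refine Relation.ReflTransGen.tail hx ?_
    rcases Nat.mod_two_eq_zero_or_one n with h | h
    · exact Or.inl (congrFun (apply_eq_of_mod_two (partTau_periodic hL)
        (show n % 2 = 0 % 2 by omega)) x)
    · exact Or.inr (congrFun (apply_eq_of_mod_two (partTau_periodic hL)
        (show n % 2 = 1 % 2 by omega)) x)
  have key : ∀ n, altProd s L 0 n β ∈ positiveRoots Φ b ∧
      altProd s L 0 n β ∈ dihedralOrbit (partTau s b L 0) (partTau s b L 1) β := by
    intro n
    induction n with
    | zero => exact ⟨hβ, Relation.ReflTransGen.refl⟩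
    | succ n ih =>
      have hnot : ¬∃ i ∈ L (0 + n), altProd s L 0 n β = b i := by
        rintro ⟨i, hi, heq⟩
        have h1 := hclosed (0 + n) _ ih.2
        rw [heq, H.partTau_simple hL hi] at h1
        exact hn i h1
      refine ⟨partProd_mem_positiveRoots H hL ih.1 hnot, ?_⟩
      have h1 := hclosed (0 + n) _ ih.2
      rwa [H.partTau_of_mem_positiveRoots ih.1] at h1
  exact H.map_negative (altProd_mem 0 m) (altProd_simple_notMem H hL hm0 hpos hneg 0) hβ (key m).1

theorem xor_dihedralOrbit [Nonempty ι] (H : IsSimpleSystem Φ b s) (hL : IsBipartition b L)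
    {w₀ : V ≃ₗᵢ[ℝ] V} (hw₀ : w₀ ∈ Subgroup.closure (Set.range s))
    (hneg₀ : ∀ i, w₀ (b i) ∉ positiveRoots Φ b) {β : V} (hβ : β ∈ almostPositiveRoots Φ b) :
    Xor'
      (2 * (dihedralOrbit (partTau s b L 0) (partTau s b L 1) β).ncard =
          orderOf (partProd s L 1 * partProd s L 0) + 2 ∧
        ∃ γ : V, dihedralOrbit (partTau s b L 0) (partTau s b L 1) β ∩ {x | ∃ i, x = -b i} = {γ} ∧
          w₀ γ = -γ)
      ((dihedralOrbit (partTau s b L 0) (partTau s b L 1) β).ncard =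
          orderOf (partProd s L 1 * partProd s L 0) + 2 ∧
        ∃ γ γ' : V, γ ≠ γ' ∧
          dihedralOrbit (partTau s b L 0) (partTau s b L 1) β ∩ {x | ∃ i, x = -b i} = {γ, γ'} ∧
          -(w₀ γ) = γ') := by
  obtain ⟨m, hm0, hm⟩ := exists_period H hL
  have hpos := fun k i hi => (hm k i hi).1
  have hneg := fun k i hi => (hm k i hi).2.1
  rw [orderOf_bipartite_coxeter H hL hm0 hpos hneg fun k i hi => (hm k i hi).2.2]
  obtain ⟨i, hi⟩ := exists_neg_simple_mem_dihedralOrbit H hL hm0 hpos hneg hβ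
  obtain ⟨k, hik⟩ := exists_mem_part hL i
  have hinv := fun n x hx => H.partTau_involutive (β := x) hL n hx
  rw [dihedralOrbit_eq_of_mem (fun x hx => (hinv 0 x hx).1) (fun x hx => (hinv 1 x hx).1)
    (fun x hx => (hinv 0 x hx).2) (fun x hx => (hinv 1 x hx).2) hβ hi]
  obtain ⟨hinter, hone, htwo⟩ := dihedralOrbit_neg_simple H hL hpos hneg hik
  have hw : altProd s L k m = w₀ := H.eq_of_forall_notMem_positiveRoots (altProd_mem k m) hw₀
    (altProd_simple_notMem H hL hm0 hpos hneg k) hneg₀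
  rw [hw] at hinter hone htwo
  by_cases heq : -b i = w₀ (b i)
  · refine Or.inl ⟨⟨hone heq, -b i, ?_, ?_⟩, ?_⟩
    · rw [hinter, ← heq, Set.pair_eq_singleton]
    · rw [map_neg, ← heq]
    · rintro ⟨h, _⟩
      have := hone heq
      omega
  · refine Or.inr ⟨⟨htwo heq, -b i, w₀ (b i), heq, hinter, ?_⟩, ?_⟩
    · rw [map_neg, neg_neg]
    · rintro ⟨h, _⟩
      have := htwo heq
      omega

end Tau

end IsSimpleSystem

/-- Let `Φ` be a finite reduced irreducible (crystallographic) root system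
spanning `V`, with simple roots `α i` (`i : ι`), positive roots `Pos`, and almost positive
roots `AP = Pos ∪ (-Π)`.  Let `S = S₊ ∪ S₋` be a bipartition of the simple reflections into
commuting parts (encoded by the lists `lp`, `lm`), `c_ε` the product of the part `S_ε`,
`c = c₋ c₊` the bipartite Coxeter element, `h = orderOf c` the Coxeter number, and `w₀` the
longest element of the Weyl group `W = ⟨S⟩`.  Then `τ₊` and `τ₋` are well-defined
involutions of `AP`, and for every `β ∈ AP` the `⟨τ₊, τ₋⟩`-orbit of `β` either (i) has
`(h+2)/2` elements and meets `-Π` in a single root `γ`, with `w₀ γ = -γ`; or (ii) has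
`h + 2` elements and meets `-Π` in exactly two roots `γ ≠ γ'`, with `-w₀ γ = γ'`; and
exactly one of (i), (ii) holds. -/
theorem tau_orbits_of_almost_positive_roots
    [FiniteDimensional ℝ V] {ι : Type*} [Fintype ι]
    (Φ : Set V) (hfin : Φ.Finite) (hspan : Submodule.span ℝ Φ = ⊤) (h0 : (0 : V) ∉ Φ)
    (hreduced : ∀ β ∈ Φ, ∀ r : ℝ, r • β ∈ Φ → r = 1 ∨ r = -1)
    (hrefl : ∀ β ∈ Φ, ∀ γ ∈ Φ, γ - (2 * ⟪γ, β⟫ / ⟪β, β⟫) • β ∈ Φ)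
    (hcrys : ∀ β ∈ Φ, ∀ γ ∈ Φ, ∃ z : ℤ, 2 * ⟪γ, β⟫ / ⟪β, β⟫ = (z : ℝ))
    (hirr : ∀ Φ₁ Φ₂ : Set V, Φ₁.Nonempty → Φ₂.Nonempty → Φ₁ ∪ Φ₂ = Φ →
      (∀ x ∈ Φ₁, ∀ y ∈ Φ₂, ⟪x, y⟫ = 0) → False)
    -- the simple roots `α i`, a base of the root system
    (α : ι → V) (hα : ∀ i, α i ∈ Φ) (hind : LinearIndependent ℝ α)
    (hbase : ∀ β ∈ Φ,
      (∃ coef : ι → ℝ, (∀ i, 0 ≤ coef i) ∧ β = ∑ i, coef i • α i) ∨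
      (∃ coef : ι → ℝ, (∀ i, 0 ≤ coef i) ∧ β = -∑ i, coef i • α i))
    -- the simple reflections `s i` and the Weyl group `W`
    (s : ι → (V ≃ₗᵢ[ℝ] V))
    (hs : ∀ i, ∀ v : V, s i v = v - (2 * ⟪v, α i⟫ / ⟪α i, α i⟫) • α i)
    -- the longest element `w₀` of `W`, where the length of `w ∈ W` is the minimal length
    -- of a word in the simple reflections with product `w`
    (w0 : V ≃ₗᵢ[ℝ] V) (hw0mem : w0 ∈ Subgroup.closure (Set.range s))
    (hw0 : ∀ u ∈ Subgroup.closure (Set.range s),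
      sInf {k : ℕ | ∃ l : List ι, l.length = k ∧ (l.map s).prod = u} ≤
        sInf {k : ℕ | ∃ l : List ι, l.length = k ∧ (l.map s).prod = w0})
    -- the bipartition `S = S₊ ∪ S₋` into two commuting parts
    (lp lm : List ι) (hlpnd : lp.Nodup) (hlmnd : lm.Nodup)
    (hpart : ∀ i : ι, i ∈ lp ↔ i ∉ lm)
    (hcommp : ∀ i ∈ lp, ∀ j ∈ lp, Commute (s i) (s j))
    (hcommm : ∀ i ∈ lm, ∀ j ∈ lm, Commute (s i) (s j))
    (cplus cminus c : V ≃ₗᵢ[ℝ] V)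
    (hcplus : cplus = (lp.map s).prod)
    (hcminus : cminus = (lm.map s).prod)
    (hc : c = cminus * cplus) :
    -- `τ₊` and `τ₋` are well-defined involutions of the almost positive roots
    (∀ β ∈ ({β ∈ Φ | ∃ coef : ι → ℝ, (∀ i, 0 ≤ coef i) ∧ β = ∑ i, coef i • α i} ∪
        {x : V | ∃ i, x = -α i}),
      tauMap lm α cplus β ∈
        ({β ∈ Φ | ∃ coef : ι → ℝ, (∀ i, 0 ≤ coef i) ∧ β = ∑ i, coef i • α i} ∪
          {x : V | ∃ i, x = -α i}) ∧
      tauMap lm α cplus (tauMap lm α cplus β) = β ∧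
      tauMap lp α cminus β ∈
        ({β ∈ Φ | ∃ coef : ι → ℝ, (∀ i, 0 ≤ coef i) ∧ β = ∑ i, coef i • α i} ∪
          {x : V | ∃ i, x = -α i}) ∧
      tauMap lp α cminus (tauMap lp α cminus β) = β) ∧
    -- and the `⟨τ₊, τ₋⟩`-orbit of each almost positive root is as described
    (∀ β ∈ ({β ∈ Φ | ∃ coef : ι → ℝ, (∀ i, 0 ≤ coef i) ∧ β = ∑ i, coef i • α i} ∪
        {x : V | ∃ i, x = -α i}),
      Xor'
        (2 * (dihedralOrbit (tauMap lm α cplus) (tauMap lp α cminus) β).ncard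
            = orderOf c + 2 ∧
          ∃ γ : V, dihedralOrbit (tauMap lm α cplus) (tauMap lp α cminus) β ∩
              {x : V | ∃ i, x = -α i} = {γ} ∧ w0 γ = -γ)
        ((dihedralOrbit (tauMap lm α cplus) (tauMap lp α cminus) β).ncard
            = orderOf c + 2 ∧
          ∃ γ γ' : V, γ ≠ γ' ∧
            dihedralOrbit (tauMap lm α cplus) (tauMap lp α cminus) β ∩
              {x : V | ∃ i, x = -α i} = {γ, γ'} ∧ -(w0 γ) = γ')) := by
  obtain ⟨b, rfl⟩ : ∃ b : Module.Basis ι ℝ V, ⇑b = α := by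
    have htop : ⊤ ≤ Submodule.span ℝ (Set.range α) := by
      rw [← hspan, Submodule.span_le]
      have hmem : ∀ coef : ι → ℝ, ∑ i, coef i • α i ∈ Submodule.span ℝ (Set.range α) :=
        fun coef => Submodule.sum_mem _ fun i _ =>
          Submodule.smul_mem _ _ (Submodule.subset_span ⟨i, rfl⟩)
      intro β hβ
      rcases hbase β hβ with ⟨coef, _, rfl⟩ | ⟨coef, _, rfl⟩
      · exact hmem coef
      · exact Submodule.neg_mem _ (hmem coef)
    exact ⟨Module.Basis.mk hind htop, Module.Basis.coe_mk hind htop⟩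
  have H : IsSimpleSystem Φ b s :=
    { finite := hfin
      zero_notMem := h0
      reduced := hreduced
      neg_mem := by
        intro β hβ
        have hne : ⟪β, β⟫ ≠ 0 := by
          rw [Ne, inner_self_eq_zero]
          rintro rfl
          exact h0 hβ
        have h := hrefl β hβ β hβ
        rw [mul_div_assoc, div_self hne] at h
        convert h using 1
        module
      simple_mem := hα
      refl_mem := by
        intro i β hβ
        rw [hs]
        exact hrefl (b i) (hα i) β hβ
      refl_apply := hs
      repr_sign := by
        intro β hβ
        rcases hbase β hβ with ⟨coef, hcoef, rfl⟩ | ⟨coef, hcoef, rfl⟩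
        · left
          intro i
          rw [b.repr_sum_self]
          exact hcoef i
        · right
          intro i
          rw [map_neg, Finsupp.neg_apply, b.repr_sum_self]
          exact neg_nonpos.2 (hcoef i)
      irreducible := hirr }
  have hPos : {β ∈ Φ | ∃ coef : ι → ℝ, (∀ i, 0 ≤ coef i) ∧ β = ∑ i, coef i • b i} =
      positiveRoots Φ b := by
    ext β
    refine and_congr_right fun _ => ⟨?_, fun h => ⟨b.repr β, h, (b.sum_repr β).symm⟩⟩
    rintro ⟨coef, hcoef, rfl⟩ i
    rw [b.repr_sum_self]
    exact hcoef i
  let L : ℕ → List ι := fun n => if n % 2 = 0 then lp else lm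
  have hL : IsBipartition b L :=
    { periodic := fun n => by simp [L]
      nodup := fun n => by
        rcases Nat.mod_two_eq_zero_or_one n with h | h <;> simpa [L, h]
      mem_succ_iff := fun n i => by
        rcases Nat.mod_two_eq_zero_or_one n with h | h
        · have h' : (n + 1) % 2 = 1 := by omega
          simp [L, h, h', hpart i]
        · have h' : (n + 1) % 2 = 0 := by omega
          simp [L, h, h', hpart i]
      orthogonal := fun n i hi j hj hij => by
        refine H.inner_eq_zero_of_commute hij ?_
        rcases Nat.mod_two_eq_zero_or_one n with h | h
        · simp only [L, h] at hi hj
          exact hcommp i hi j hj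
        · simp only [L, h] at hi hj
          exact hcommm i hi j hj }
  have hp : tauMap lm b cplus = IsSimpleSystem.partTau s b L 0 := by rw [hcplus]; rfl
  have hm : tauMap lp b cminus = IsSimpleSystem.partTau s b L 1 := by rw [hcminus]; rfl
  have hcox : c = partProd s L 1 * partProd s L 0 := by rw [hc, hcplus, hcminus]; rfl
  rw [hPos, hp, hm, hcox]
  refine ⟨fun β hβ => ?_, fun β hβ => ?_⟩
  · obtain ⟨h1, h2⟩ := H.partTau_involutive hL 0 hβ
    obtain ⟨h3, h4⟩ := H.partTau_involutive hL 1 hβ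
    exact ⟨h1, h2, h3, h4⟩
  · have : Nonempty ι := by
      rcases hβ with hβ | ⟨i, _⟩
      · by_contra hn
        rw [not_nonempty_iff] at hn
        refine h0 ?_
        rw [← Fintype.sum_empty fun i => b.repr β i • b i, b.sum_repr]
        exact hβ.1
      · exact ⟨i⟩
    exact H.xor_dihedralOrbit hL hw0mem (H.longest_apply_simple_notMem hw0mem hw0) hβ

end
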